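/- Let L be a Leibniz algebra over a field 𝕜 with left center Z, and let ω ∈ C̃^n(L), η ∈ C̃^m(L), λ ∈ C̃^l(L) be representable cochains. Then the bracket satisfies the graded Leibniz rule with respect to the multiplication: {ω, η·λ} = {ω,η}·λ + (−1)^{nm} η·{ω,λ}. -/

import Mathlib

open scoped TensorProduct

universe u v w

/-- A (left) Leibniz algebra over a field `𝕜`. -/
structure LeibnizAlg (𝕜 : Type u) [Field 𝕜] (L : Type v) [AddCommGroup L] [Module 𝕜 L] where
  br : L →ₗ[𝕜] L →ₗ[𝕜] L
  leibniz : ∀ a b c : L, br a (br b c) = br (br a b) c + br b (br a c)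

namespace LeibnizAlg

variable {𝕜 : Type u} [Field 𝕜] {L : Type v} [AddCommGroup L] [Module 𝕜 L]
variable (A : LeibnizAlg 𝕜 L)

/-- The left center `Z = {z | z ∘ e = 0 for all e}`. -/
def leftCenter : Submodule 𝕜 L where
  carrier := {z | ∀ e : L, A.br z e = 0}
  add_mem' := by
    intro a b ha hb
    simp only [Set.mem_setOf_eq] at *
    intro e
    rw [map_add, LinearMap.add_apply, ha e, hb e, add_zero]
  zero_mem' := by
    simp only [Set.mem_setOf_eq]
    intro e
    rw [map_zero, LinearMap.zero_apply]
  smul_mem' := by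
    intro c x hx
    simp only [Set.mem_setOf_eq] at *
    intro e
    rw [map_smul, LinearMap.smul_apply, hx e, smul_zero]

lemma mem_leftCenter_iff {z : L} : z ∈ A.leftCenter ↔ ∀ e : L, A.br z e = 0 := Iff.rfl

/-- The symmetric product `(a,b) = a∘b + b∘a`. -/
def sp (a b : L) : L := A.br a b + A.br b a

lemma sp_mem (a b : L) : A.sp a b ∈ A.leftCenter := by
  rw [mem_leftCenter_iff]
  intro e
  have h1 := A.leibniz a b e
  have h2 := A.leibniz b a e
  have hx : A.br (A.br a b) e = A.br a (A.br b e) - A.br b (A.br a e) :=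
    eq_sub_iff_add_eq.mpr h1.symm
  have hy : A.br (A.br b a) e = A.br b (A.br a e) - A.br a (A.br b e) :=
    eq_sub_iff_add_eq.mpr h2.symm
  rw [sp, map_add, LinearMap.add_apply, hx, hy]
  abel

/-- The symmetric product, seen as valued in the left center. -/
def spZ (a b : L) : A.leftCenter := ⟨A.sp a b, A.sp_mem a b⟩

lemma br_mem (e : L) (f : A.leftCenter) : A.br e (f : L) ∈ A.leftCenter := by
  rw [mem_leftCenter_iff]
  intro e'
  have h := A.leibniz e (f : L) e'
  have hf : A.br (f : L) e' = 0 := (A.mem_leftCenter_iff.mp f.2) e'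
  have hf2 : A.br (f : L) (A.br e e') = 0 := (A.mem_leftCenter_iff.mp f.2) _
  rw [hf] at h
  rw [map_zero] at h
  rw [hf2, add_zero] at h
  exact h.symm

/-- The bracket of `L` on its left center. -/
def brZ (e : L) (f : A.leftCenter) : A.leftCenter := ⟨A.br e (f : L), A.br_mem e f⟩

/-- The symmetric product as a bilinear map into the left center. -/
noncomputable def spL : L →ₗ[𝕜] L →ₗ[𝕜] A.leftCenter :=
  LinearMap.mk₂ 𝕜 A.spZ
    (fun a a' b => Subtype.ext (by
      simp only [spZ, sp, map_add, LinearMap.add_apply, Submodule.coe_add]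
      abel))
    (fun c a b => Subtype.ext (by
      simp only [spZ, sp, map_smul, LinearMap.smul_apply, SetLike.val_smul, smul_add]))
    (fun a b b' => Subtype.ext (by
      simp only [spZ, sp, map_add, LinearMap.add_apply, Submodule.coe_add]
      abel))
    (fun c a b => Subtype.ext (by
      simp only [spZ, sp, map_smul, LinearMap.smul_apply, SetLike.val_smul, smul_add]))

end LeibnizAlg

/-- `(S, ι)` is (a model of) the symmetric algebra of the module `Z`:
it satisfies the universal property. -/
def IsSymAlg {𝕜 : Type u} [Field 𝕜] {Z : Type v} [AddCommGroup Z] [Module 𝕜 Z]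
    (S : Type w) [CommRing S] [Algebra 𝕜 S] (ι : Z →ₗ[𝕜] S) : Prop :=
  ∀ (B : Type (max u v w)) [CommRing B] [Algebra 𝕜 B] (g : Z →ₗ[𝕜] B),
    ∃! h : S →ₐ[𝕜] B, ∀ z : Z, h (ι z) = g z

section Shuffles

/-- All ways of splitting a list into a signed pair of complementary subsequences. -/
def shSplits {α : Type*} : List α → List (ℤ × List α × List α)
  | [] => [(1, [], [])]
  | a :: l =>
      ((shSplits l).map fun t => (t.1, a :: t.2.1, t.2.2)) ++
      ((shSplits l).map fun t => ((-1) ^ t.2.1.length * t.1, t.2.1, a :: t.2.2))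

/-- Signed sum over all `(p, l.length - p)`-shuffles of the list `l`. -/
def shSum {α : Type*} {S : Type*} [AddCommGroup S] (p : ℕ) (l : List α)
    (F : List α → List α → S) : S :=
  (((shSplits l).filter fun t => t.2.1.length == p).map fun t => t.1 • F t.2.1 t.2.2).sum

/-- Unsigned sum over all `(p, l.length - p)`-shuffles of the list `l`. -/
def shSumU {α : Type*} {S : Type*} [AddCommMonoid S] (p : ℕ) (l : List α)
    (F : List α → List α → S) : S :=
  (((shSplits l).filter fun t => t.2.1.length == p).map fun t => F t.2.1 t.2.2).sum

end Shuffles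

section Cochains

variable {𝕜 : Type u} [Field 𝕜] {L : Type v} [AddCommGroup L] [Module 𝕜 L]
variable (A : LeibnizAlg 𝕜 L)
variable (S : Type w) [CommRing S] [Algebra 𝕜 S]
variable (ι : A.leftCenter →ₗ[𝕜] S)

/-- `ω` is an `n`-cochain in the standard complex `C(L) = C(L, Z, S^•(Z))`:
its component `ω k`, defined on tuples `es` of `n - 2k` elements of `L` and `k`
elements of the left center, is multilinear, symmetric in the `Z`-arguments, and
weakly skew-symmetric in the `L`-arguments. -/
structure IsCochain (n : ℕ) (ω : ℕ → List L → List A.leftCenter → S) : Prop where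
  add_e : ∀ (k : ℕ) (p q : List L) (x y : L) (fs : List A.leftCenter),
    2*k + (p.length + 1 + q.length) = n → fs.length = k →
    ω k (p ++ (x + y) :: q) fs = ω k (p ++ x :: q) fs + ω k (p ++ y :: q) fs
  smul_e : ∀ (k : ℕ) (p q : List L) (c : 𝕜) (x : L) (fs : List A.leftCenter),
    2*k + (p.length + 1 + q.length) = n → fs.length = k →
    ω k (p ++ (c • x) :: q) fs = c • ω k (p ++ x :: q) fs
  add_f : ∀ (k : ℕ) (es : List L) (p q : List A.leftCenter) (x y : A.leftCenter),
    2*k + es.length = n → p.length + 1 + q.length = k →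
    ω k es (p ++ (x + y) :: q) = ω k es (p ++ x :: q) + ω k es (p ++ y :: q)
  smul_f : ∀ (k : ℕ) (es : List L) (p q : List A.leftCenter) (c : 𝕜) (x : A.leftCenter),
    2*k + es.length = n → p.length + 1 + q.length = k →
    ω k es (p ++ (c • x) :: q) = c • ω k es (p ++ x :: q)
  symm_f : ∀ (k : ℕ) (es : List L) (p q : List A.leftCenter) (x y : A.leftCenter),
    2*k + es.length = n → p.length + 2 + q.length = k →
    ω k es (p ++ x :: y :: q) = ω k es (p ++ y :: x :: q)
  skew : ∀ (k : ℕ) (p q : List L) (x y : L) (fs : List A.leftCenter),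
    2*k + (p.length + 2 + q.length) = n → fs.length = k →
    ω k (p ++ x :: y :: q) fs + ω k (p ++ y :: x :: q) fs
      = - ω (k+1) (p ++ q) (A.spZ x y :: fs)

/-- The product of an `n`-cochain and an `m`-cochain. -/
def cmul (n m : ℕ) (ω η : ℕ → List L → List A.leftCenter → S) :
    ℕ → List L → List A.leftCenter → S :=
  fun k es fs => ∑ i ∈ Finset.range (k+1),
    if 2*i ≤ n ∧ 2*(k-i) ≤ m then
      shSum (n - 2*i) es fun es₁ es₂ =>
        shSumU i fs fun fs₁ fs₂ => ω i es₁ fs₁ * η (k-i) es₂ fs₂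
    else 0

/-- The operator `d₀` of the standard complex, where `ρ` is the action of `L` on
`S^•(Z)` by derivations. -/
def cd0 (ρ : L → Derivation 𝕜 S S) (ω : ℕ → List L → List A.leftCenter → S) :
    ℕ → List L → List A.leftCenter → S :=
  fun k es fs =>
    (∑ a ∈ Finset.range es.length,
      (-1 : ℤ)^a • ρ (es.getD a 0) (ω k (es.eraseIdx a) fs))
    + ∑ a ∈ Finset.range es.length, ∑ b ∈ Finset.Ico (a+1) es.length,
        (-1 : ℤ)^(a+1) •
          ω k ((es.eraseIdx a).set (b-1) (A.br (es.getD a 0) (es.getD b 0))) fs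

/-- The operator `δ` of the standard complex. -/
def cdel (ω : ℕ → List L → List A.leftCenter → S) :
    ℕ → List L → List A.leftCenter → S :=
  fun k es fs => ∑ j ∈ Finset.range fs.length,
    ω (k-1) (((fs.getD j 0 : A.leftCenter) : L) :: es) (fs.eraseIdx j)

/-- The symmetric product with values pushed into `S = S^•(Z)`. -/
noncomputable def spS : L →ₗ[𝕜] L →ₗ[𝕜] S := (A.spL).compr₂ ι

/-- The `S^•(Z)`-bilinear extension of the symmetric product to `S^•(Z) ⊗ L`. -/
noncomputable def pairT : (S ⊗[𝕜] L) →ₗ[𝕜] (S ⊗[𝕜] L) →ₗ[𝕜] S :=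
  TensorProduct.curry <|
    (TensorProduct.lift (LinearMap.mul 𝕜 S)).comp <|
      (TensorProduct.map (TensorProduct.lift (LinearMap.mul 𝕜 S))
        (TensorProduct.lift (spS A S ι))).comp
        (TensorProduct.tensorTensorTensorComm 𝕜 S L S L).toLinearMap

/-- `ω` is a representable `n`-cochain: each of the maps
`e ↦ ω k (es ++ [e]) fs` lies in the image of `φ = pairT`. -/
def IsRepr (n : ℕ) (ω : ℕ → List L → List A.leftCenter → S) : Prop :=
  ∀ (k : ℕ) (es : List L) (fs : List A.leftCenter),
    2*k + (es.length + 1) = n → fs.length = k →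
    ∃ x : S ⊗[𝕜] L, ∀ e : L, pairT A S ι x ((1 : S) ⊗ₜ[𝕜] e) = ω k (es ++ [e]) fs

/-- `ωt` is a choice of `φ`-preimages `ω̃` for the representable cochain `ω`. -/
def IsPre (n : ℕ) (ω : ℕ → List L → List A.leftCenter → S)
    (ωt : ℕ → List L → List A.leftCenter → S ⊗[𝕜] L) : Prop :=
  ∀ (k : ℕ) (es : List L) (fs : List A.leftCenter),
    2*k + (es.length + 1) = n → fs.length = k →
    ∀ e : L, pairT A S ι (ωt k es fs) ((1 : S) ⊗ₜ[𝕜] e) = ω k (es ++ [e]) fs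

/-- `ωc k es x fs` is the extension `ω̌` of `ω (k+1) es (·::fs)` from `Z` to all of
`S = S^•(Z)` in its first `Z`-slot, by the Leibniz rule. -/
structure IsExt (n : ℕ) (ω : ℕ → List L → List A.leftCenter → S)
    (ωc : ℕ → List L → S → List A.leftCenter → S) : Prop where
  on_gen : ∀ (k : ℕ) (es : List L) (fs : List A.leftCenter) (f : A.leftCenter),
    2*(k+1) + es.length = n → fs.length = k →
    ωc k es (ι f) fs = ω (k+1) es (f :: fs)
  map_add : ∀ (k : ℕ) (es : List L) (fs : List A.leftCenter) (x y : S),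
    2*(k+1) + es.length = n → fs.length = k →
    ωc k es (x + y) fs = ωc k es x fs + ωc k es y fs
  map_smul : ∀ (k : ℕ) (es : List L) (fs : List A.leftCenter) (c : 𝕜) (x : S),
    2*(k+1) + es.length = n → fs.length = k →
    ωc k es (c • x) fs = c • ωc k es x fs
  mul_rule : ∀ (k : ℕ) (es : List L) (fs : List A.leftCenter) (x y : S),
    2*(k+1) + es.length = n → fs.length = k →
    ωc k es (x * y) fs = x * ωc k es y fs + y * ωc k es x fs

/-- The operation `ω ◇ η` built from the Leibniz-rule extension `ωc` of `ω`. -/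
def cdiam (n m : ℕ) (ωc : ℕ → List L → S → List A.leftCenter → S)
    (η : ℕ → List L → List A.leftCenter → S) : ℕ → List L → List A.leftCenter → S :=
  fun k es fs => ∑ i ∈ Finset.range (k+1),
    if 2*(i+1) ≤ n ∧ 2*(k-i) ≤ m then
      shSum (n - 2*i - 2) es fun es₁ es₂ =>
        shSumU (k-i) fs fun fs₁ fs₂ => ωc i es₁ (η (k-i) es₂ fs₁) fs₂
    else 0

/-- The operation `ω • η` built from chosen `φ`-preimages `ωt`, `ηt`. -/
noncomputable def cbull (n m : ℕ)
    (ωt ηt : ℕ → List L → List A.leftCenter → S ⊗[𝕜] L) :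
    ℕ → List L → List A.leftCenter → S :=
  fun k es fs => (-1 : ℤ)^(m-1) • ∑ i ∈ Finset.range (k+1),
    if 2*i + 1 ≤ n ∧ 2*(k-i) + 1 ≤ m then
      shSum (n - 2*i - 1) es fun es₁ es₂ =>
        shSumU i fs fun fs₁ fs₂ => pairT A S ι (ωt i es₁ fs₁) (ηt (k-i) es₂ fs₂)
    else 0

/-- The bracket `{ω, η} = ω•η + ω◇η − (−1)^{nm} η◇ω` of representable cochains. -/
noncomputable def cpbr (n m : ℕ)
    (ω η : ℕ → List L → List A.leftCenter → S)
    (ωt ηt : ℕ → List L → List A.leftCenter → S ⊗[𝕜] L)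
    (ωc ηc : ℕ → List L → S → List A.leftCenter → S) :
    ℕ → List L → List A.leftCenter → S :=
  fun k es fs => cbull A S ι n m ωt ηt k es fs + cdiam A S n m ωc η k es fs
    - (-1 : ℤ)^(n*m) • cdiam A S m n ηc ω k es fs

/-- The canonical 3-cochain `Θ`. -/
def ThetaC : ℕ → List L → List A.leftCenter → S :=
  fun k es fs => match k, es, fs with
    | 0, [e₁, e₂, e₃], [] => ι (A.spZ (A.br e₁ e₂) e₃)
    | 1, [e], [f] => - ι (A.spZ e (f : L))
    | _, _, _ => 0

/-- The 2-cochain `ζ` with `ζ₀ = (·,·)` and `ζ₁(f) = −2f`. -/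
def zetaC : ℕ → List L → List A.leftCenter → S :=
  fun k es fs => match k, es, fs with
    | 0, [e₁, e₂], [] => ι (A.spZ e₁ e₂)
    | 1, [], [f] => (-2 : 𝕜) • ι f
    | _, _, _ => 0

/-- The representable 1-cochain `e^♭ = (e, ·)`. -/
def eflat (e : L) : ℕ → List L → List A.leftCenter → S :=
  fun k es fs => match k, es, fs with
    | 0, [e'], [] => ι (A.spZ e e')
    | _, _, _ => 0

end Cochains

section WeightedShuffles

variable {α β M N : Type*} [AddCommGroup M] [AddCommGroup N]

/-- The sum over all shuffles of a list, weighted by `ε` to the number of inversions. -/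
def shw (ε : ℤ) : List α → (List α → List α → M) → M
  | [], F => F [] []
  | a :: l, F => shw ε l (fun x y => F (a :: x) y)
      + shw ε l (fun x y => ε ^ x.length • F x (a :: y))

lemma shw_congr (ε : ℤ) (l : List α) {F G : List α → List α → M}
    (h : ∀ x y, x.length + y.length = l.length → F x y = G x y) :
    shw ε l F = shw ε l G := by
  induction l generalizing F G with
  | nil => exact h [] [] rfl
  | cons a l ih =>
    rw [shw, shw]
    congr 1
    · exact ih fun x y hxy => h _ _ (by simp only [List.length_cons]; omega)
    · exact ih fun x y hxy => by rw [h _ _ (by simp only [List.length_cons]; omega)]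

lemma shw_zero (ε : ℤ) (l : List α) : shw ε l (fun _ _ => (0 : M)) = 0 := by
  induction l with
  | nil => rfl
  | cons a l ih => simp only [shw, smul_zero, ih, add_zero]

lemma shw_add (ε : ℤ) (l : List α) (F G : List α → List α → M) :
    shw ε l (fun x y => F x y + G x y) = shw ε l F + shw ε l G := by
  induction l generalizing F G with
  | nil => rfl
  | cons a l ih =>
    simp only [shw, smul_add, ih]
    abel

lemma shw_map (ε : ℤ) (l : List α) (g : M →+ N) (F : List α → List α → M) :
    g (shw ε l F) = shw ε l (fun x y => g (F x y)) := by
  induction l generalizing F with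
  | nil => rfl
  | cons a l ih => simp only [shw, map_add, ih, map_zsmul]

lemma shw_smul (ε c : ℤ) (l : List α) (F : List α → List α → M) :
    shw ε l (fun x y => c • F x y) = c • shw ε l F :=
  (shw_map ε l (DistribSMul.toAddMonoidHom M c) F).symm

lemma shw_comm (ε δ : ℤ) (l : List α) (l' : List β)
    (F : List α → List α → List β → List β → M) :
    shw ε l (fun x y => shw δ l' (F x y))
      = shw δ l' (fun u v => shw ε l (fun x y => F x y u v)) := by
  induction l generalizing F with
  | nil => rfl
  | cons a l ih =>
    simp only [shw]
    simp only [← shw_smul, ih, shw_add]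

lemma shw_sum (ε : ℤ) (l : List α) (s : Finset β) (F : β → List α → List α → M) :
    shw ε l (fun x y => ∑ i ∈ s, F i x y) = ∑ i ∈ s, shw ε l (F i) := by
  classical
  induction s using Finset.induction_on with
  | empty => simp only [Finset.sum_empty, shw_zero]
  | insert a s ha ih => simp only [Finset.sum_insert ha, shw_add, ih]

lemma shw_assoc (ε : ℤ) (l : List α) (F : List α → List α → List α → M) :
    shw ε l (fun x z => shw ε x (fun u v => F u v z))
      = shw ε l (fun u x => shw ε x (fun v z => F u v z)) := by
  induction l generalizing F with
  | nil => rfl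
  | cons a l ih =>
    have h : ∀ x z, ε ^ x.length • shw ε x (fun u v => F u v (a :: z))
        = shw ε x (fun u v => (ε ^ u.length * ε ^ v.length) • F u v (a :: z)) := by
      intro x z
      rw [← shw_smul]
      exact shw_congr _ _ fun u v huv => by rw [← huv, pow_add]
    simp only [shw, h, shw_add, ih, smul_add]
    rw [add_assoc]
    simp only [← shw_smul, smul_smul]

lemma shw_swap (ε : ℤ) (hε : ε * ε = 1) (l : List α) (F : List α → List α → M) :
    shw ε l F = shw ε l (fun x y => ε ^ (x.length * y.length) • F y x) := by
  induction l generalizing F with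
  | nil => simp [shw]
  | cons a l ih =>
    have hsq : ∀ k, ε ^ k * ε ^ k = 1 := fun k => by rw [← mul_pow, hε, one_pow]
    rw [shw, shw, add_comm, ih, ih fun x y => F (a :: x) y]
    congr 1
    · refine shw_congr _ _ fun x y _ => ?_
      rw [smul_smul, ← pow_add, List.length_cons]
      congr 2
      ring
    · refine shw_congr _ _ fun x y _ => ?_
      rw [smul_smul, List.length_cons, mul_add, mul_one, pow_add, mul_left_comm, hsq, mul_one]

lemma shw_snoc (ε : ℤ) (l : List α) (a : α) (F : List α → List α → M) :
    shw ε (l ++ [a]) F = shw ε l (fun x y => ε ^ y.length • F (x ++ [a]) y)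
      + shw ε l (fun x y => F x (y ++ [a])) := by
  induction l generalizing F with
  | nil => simp [shw]
  | cons b l ih =>
    simp only [List.cons_append, shw, ih, List.length_append, List.length_cons, List.length_nil,
      smul_smul, zero_add]
    have h : (fun x y : List α => (ε ^ y.length * ε ^ (x.length + 1)) • F (x ++ [a]) (b :: y))
        = fun x y => (ε ^ x.length * ε ^ (y.length + 1)) • F (x ++ [a]) (b :: y) := by
      funext x y
      congr 1
      ring
    rw [h]
    abel

lemma sum_shSplits (l : List α) (F : List α → List α → M) :
    ((shSplits l).map fun t => t.1 • F t.2.1 t.2.2).sum = shw (-1) l F := by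
  induction l generalizing F with
  | nil => simp [shSplits, shw]
  | cons a l ih =>
    rw [shSplits, List.map_append, List.sum_append, List.map_map, List.map_map, shw,
      ← ih, ← ih fun x y => (-1 : ℤ) ^ x.length • F x (a :: y)]
    congr 2
    refine List.map_congr_left fun t _ => ?_
    simp only [Function.comp_apply, smul_smul, mul_comm]

lemma sum_shSplits_unsigned (l : List α) (F : List α → List α → M) :
    ((shSplits l).map fun t => F t.2.1 t.2.2).sum = shw 1 l F := by
  induction l generalizing F with
  | nil => simp [shSplits, shw]
  | cons a l ih =>
    simp only [one_pow, one_smul, shw, ← ih, shSplits, List.map_append, List.sum_append,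
      List.map_map, Function.comp_def]

lemma sum_map_filter_eq {γ : Type*} (p : γ → Bool) (g : γ → M) (s : List γ) :
    ((s.filter p).map g).sum = (s.map fun t => if p t then g t else 0).sum := by
  induction s with
  | nil => rfl
  | cons a s ih => by_cases h : p a <;> simp [h, ih]

lemma shSum_eq_shw (p : ℕ) (l : List α) (F : List α → List α → M) :
    shSum p l F = shw (-1) l (fun x y => if x.length = p then F x y else 0) := by
  rw [shSum, sum_map_filter_eq, ← sum_shSplits]
  simp only [beq_iff_eq, smul_ite, smul_zero]

lemma shSumU_eq_shw (p : ℕ) (l : List α) (F : List α → List α → M) :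
    shSumU p l F = shw 1 l (fun x y => if x.length = p then F x y else 0) := by
  rw [shSumU, sum_map_filter_eq, ← sum_shSplits_unsigned]
  simp only [beq_iff_eq]

lemma shSumU_eq_shw_swap (p : ℕ) (l : List α) (F : List α → List α → M) :
    shSumU p l F = shw 1 l (fun x y => if y.length = p then F y x else 0) := by
  rw [shSumU_eq_shw, shw_swap 1 (by norm_num)]
  simp only [one_pow, one_smul]

end WeightedShuffles

section Convolution

variable {𝕜 α β : Type*} [Field 𝕜] {M N P M' N' P' : Type*}
  [AddCommGroup M] [Module 𝕜 M] [AddCommGroup N] [Module 𝕜 N] [AddCommGroup P] [Module 𝕜 P]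
  [AddCommGroup M'] [Module 𝕜 M'] [AddCommGroup N'] [Module 𝕜 N']
  [AddCommGroup P'] [Module 𝕜 P']

/-- Convolution along a bilinear map: signed shuffles in the first list, unsigned in the second. -/
def conv (b : M →ₗ[𝕜] N →ₗ[𝕜] P) (F : List α → List β → M) (G : List α → List β → N) :
    List α → List β → P :=
  fun es fs => shw (-1) es fun x y => shw 1 fs fun u v => b (F x u) (G y v)

/-- `F` vanishes outside total degree `p - a`, where the second list counts twice. -/
def SuppDeg (a p : ℕ) (F : List α → List β → M) : Prop :=
  ∀ x u, 2 * u.length + x.length + a ≠ p → F x u = 0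

/-- Truncation of `f` to total degree `p - a`. -/
def trunc (a p : ℕ) (f : ℕ → List α → List β → M) : List α → List β → M :=
  fun x u => if 2 * u.length + x.length + a = p then f u.length x u else 0

lemma suppDeg_trunc (a p : ℕ) (f : ℕ → List α → List β → M) : SuppDeg a p (trunc a p f) :=
  fun _ _ h => if_neg h

lemma SuppDeg.conv {b : M →ₗ[𝕜] N →ₗ[𝕜] P} {F : List α → List β → M}
    {G : List α → List β → N} {a c p q : ℕ} (hF : SuppDeg a p F) (hG : SuppDeg c q G) :
    SuppDeg (a + c) (p + q) (conv b F G) := by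
  intro es fs h
  rw [_root_.conv, ← shw_zero (-1) es]
  refine shw_congr _ _ fun x y hxy => ?_
  rw [← shw_zero 1 fs]
  refine shw_congr _ _ fun u v huv => ?_
  by_cases h1 : 2 * u.length + x.length + a = p
  · rw [hG y v (by omega), map_zero]
  · rw [hF x u h1, map_zero, LinearMap.zero_apply]

lemma map_conv (g : P →ₗ[𝕜] P') (b : M →ₗ[𝕜] N →ₗ[𝕜] P) (F : List α → List β → M)
    (G : List α → List β → N) (es : List α) (fs : List β) :
    g (conv b F G es fs) = conv (b.compr₂ g) F G es fs := by
  have h1 := fun F : List α → List α → P => shw_map (-1) es g.toAddMonoidHom F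
  have h2 := fun F : List β → List β → P => shw_map 1 fs g.toAddMonoidHom F
  simp only [LinearMap.toAddMonoidHom_coe] at h1 h2
  simp only [conv, h1, h2, LinearMap.compr₂_apply]

lemma conv_apply (b : M →ₗ[𝕜] N →ₗ[𝕜] P' →ₗ[𝕜] P) (F : List α → List β → M)
    (G : List α → List β → N) (es : List α) (fs : List β) (x : P') :
    conv b F G es fs x = conv (b.compr₂ (LinearMap.applyₗ x)) F G es fs :=
  map_conv (LinearMap.applyₗ x) b F G es fs

lemma conv_add_left (b : M →ₗ[𝕜] N →ₗ[𝕜] P) (F F' : List α → List β → M)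
    (G : List α → List β → N) : conv b (F + F') G = conv b F G + conv b F' G := by
  funext es fs
  simp only [conv, Pi.add_apply, map_add, LinearMap.add_apply, shw_add]

lemma conv_add_right (b : M →ₗ[𝕜] N →ₗ[𝕜] P) (F : List α → List β → M)
    (G G' : List α → List β → N) : conv b F (G + G') = conv b F G + conv b F G' := by
  funext es fs
  simp only [conv, Pi.add_apply, map_add, shw_add]

lemma conv_smul_left (b : M →ₗ[𝕜] N →ₗ[𝕜] P) (c : ℤ) (F : List α → List β → M)
    (G : List α → List β → N) : conv b (c • F) G = c • conv b F G := by
  funext es fs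
  simp only [conv, Pi.smul_apply, map_zsmul, LinearMap.smul_apply, shw_smul]

lemma conv_smul_right (b : M →ₗ[𝕜] N →ₗ[𝕜] P) (c : ℤ) (F : List α → List β → M)
    (G : List α → List β → N) : conv b F (c • G) = c • conv b F G := by
  funext es fs
  simp only [conv, Pi.smul_apply, map_zsmul, shw_smul]

lemma conv_zero_left (b : M →ₗ[𝕜] N →ₗ[𝕜] P) (G : List α → List β → N) :
    conv b (0 : List α → List β → M) G = 0 := by
  simpa using conv_smul_left b 0 0 G

lemma conv_zero_right (b : M →ₗ[𝕜] N →ₗ[𝕜] P) (F : List α → List β → M) :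
    conv b F (0 : List α → List β → N) = 0 := by
  simpa using conv_smul_right b 0 F 0

lemma conv_add_map (b b' : M →ₗ[𝕜] N →ₗ[𝕜] P) (F : List α → List β → M)
    (G : List α → List β → N) : conv (b + b') F G = conv b F G + conv b' F G := by
  funext es fs
  simp only [conv, Pi.add_apply, LinearMap.add_apply, shw_add]

lemma conv_assoc {Q : Type*} [AddCommGroup Q] [Module 𝕜 Q]
    (b : M →ₗ[𝕜] N →ₗ[𝕜] P) (b' : P →ₗ[𝕜] M' →ₗ[𝕜] Q)
    (c : N →ₗ[𝕜] M' →ₗ[𝕜] N') (c' : M →ₗ[𝕜] N' →ₗ[𝕜] Q)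
    (h : ∀ x y z, b' (b x y) z = c' x (c y z))
    (F : List α → List β → M) (G : List α → List β → N) (H : List α → List β → M') :
    conv b' (conv b F G) H = conv c' F (conv c G H) := by
  funext es fs
  have hl : ∀ (x : List α) (u : List β) (z : M'), b' (conv b F G x u) z
      = shw (-1) x fun x₁ x₂ => shw 1 u fun u₁ u₂ => c' (F x₁ u₁) (c (G x₂ u₂) z) := by
    intro x u z
    have := map_conv (b'.flip z) b F G x u
    rw [LinearMap.flip_apply] at this
    rw [this]
    simp only [conv, LinearMap.compr₂_apply, LinearMap.flip_apply, h]
  have hr : ∀ (w : M) (x : List α) (u : List β), c' w (conv c G H x u)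
      = shw (-1) x fun x₁ x₂ => shw 1 u fun u₁ u₂ => c' w (c (G x₁ u₁) (H x₂ u₂)) := by
    intro w x u
    rw [map_conv (c' w)]
    simp only [conv, LinearMap.compr₂_apply]
  rw [conv, conv]
  simp only [hl, hr]
  simp only [shw_comm 1 (-1)]
  rw [shw_assoc (-1) es fun x₁ x₂ y => shw 1 fs fun u v => shw 1 u fun u₁ u₂ =>
    c' (F x₁ u₁) (c (G x₂ u₂) (H y v))]
  refine shw_congr _ _ fun x₁ y _ => shw_congr _ _ fun x₂ z _ => ?_
  exact shw_assoc 1 fs fun u₁ u₂ v => c' (F x₁ u₁) (c (G x₂ u₂) (H z v))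

lemma conv_swap (b : M →ₗ[𝕜] N →ₗ[𝕜] P) {F : List α → List β → M}
    {G : List α → List β → N} {a c p q : ℕ} (hF : SuppDeg a p F) (hG : SuppDeg c q G) :
    conv b F G = (-1 : ℤ) ^ ((p + a) * (q + c)) • conv b.flip G F := by
  funext es fs
  rw [conv, shw_swap (-1) (by norm_num), Pi.smul_apply, Pi.smul_apply, conv, ← shw_smul]
  refine shw_congr _ _ fun x y _ => ?_
  rw [shw_swap 1 (by norm_num), ← shw_smul, ← shw_smul]
  refine shw_congr _ _ fun u v _ => ?_
  rw [one_pow, one_smul, LinearMap.flip_apply]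
  by_cases h1 : 2 * v.length + y.length + a = p
  · by_cases h2 : 2 * u.length + x.length + c = q
    · congr 1
      refine neg_one_pow_congr ?_
      rw [← h1, ← h2]
      simp only [Nat.even_mul, Nat.even_add, even_two, true_or, true_iff]
      tauto
    · rw [hG x u h2, map_zero, smul_zero, smul_zero]
  · rw [hF y v h1, map_zero, LinearMap.zero_apply, smul_zero, smul_zero]

/-- If `b' x` satisfies a Leibniz rule on products, so does convolution with `b'`. -/
lemma conv_leibniz {Q M'' : Type*} [AddCommGroup Q] [Module 𝕜 Q] [AddCommGroup M''] [Module 𝕜 M'']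
    (b' : M →ₗ[𝕜] N' →ₗ[𝕜] Q) (c : N →ₗ[𝕜] M' →ₗ[𝕜] N')
    (b₁ : M →ₗ[𝕜] N →ₗ[𝕜] P) (c₁ : P →ₗ[𝕜] M' →ₗ[𝕜] Q)
    (b₂ : M →ₗ[𝕜] M' →ₗ[𝕜] M'') (c₂ : N →ₗ[𝕜] M'' →ₗ[𝕜] Q)
    (h : ∀ x y z, b' x (c y z) = c₁ (b₁ x y) z + c₂ y (b₂ x z))
    {F : List α → List β → M} {G : List α → List β → N} {a d p q : ℕ}
    (hF : SuppDeg a p F) (hG : SuppDeg d q G) (H : List α → List β → M') :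
    conv b' F (conv c G H) = conv c₁ (conv b₁ F G) H
      + (-1 : ℤ) ^ ((p + a) * (q + d)) • conv c₂ G (conv b₂ F H) := by
  let t : M →ₗ[𝕜] N →ₗ[𝕜] M' →ₗ[𝕜] Q := LinearMap.mk₂ 𝕜 (fun x y => b' x ∘ₗ c y)
    (fun x x' y => by rw [map_add, LinearMap.add_comp])
    (fun r x y => by rw [map_smul, LinearMap.smul_comp])
    (fun x y y' => by rw [map_add, LinearMap.comp_add])
    (fun r x y => by rw [map_smul, LinearMap.comp_smul])
  let t₁ := c₁ ∘ₗ TensorProduct.lift b₁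
  let t₂ := TensorProduct.lift t - t₁
  have h₁ : conv t₁ (conv (TensorProduct.mk 𝕜 M N) F G) H = conv c₁ (conv b₁ F G) H := by
    have hb : (fun es fs => TensorProduct.lift b₁ (conv (TensorProduct.mk 𝕜 M N) F G es fs))
        = conv b₁ F G := by
      funext es fs
      rw [map_conv]
      rfl
    rw [← hb]
    rfl
  have h₂ : conv t₂ (conv (TensorProduct.mk 𝕜 M N).flip G F) H = conv c₂ G (conv b₂ F H) := by
    refine conv_assoc _ _ _ _ (fun y x z => ?_) _ _ _
    exact sub_eq_of_eq_add' (h x y z)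
  rw [← conv_assoc (TensorProduct.mk 𝕜 M N) (TensorProduct.lift t) c b' (fun x y z => rfl),
    ← add_sub_cancel t₁ (TensorProduct.lift t), conv_add_map, h₁,
    conv_swap (TensorProduct.mk 𝕜 M N) hF hG, conv_smul_left, h₂]

lemma conv_left_comm {Q M'' : Type*} [AddCommGroup Q] [Module 𝕜 Q] [AddCommGroup M'']
    [Module 𝕜 M''] (b' : M →ₗ[𝕜] N' →ₗ[𝕜] Q) (c : N →ₗ[𝕜] M' →ₗ[𝕜] N')
    (b : M →ₗ[𝕜] M' →ₗ[𝕜] M'') (c' : N →ₗ[𝕜] M'' →ₗ[𝕜] Q)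
    (h : ∀ x y z, b' x (c y z) = c' y (b x z))
    {F : List α → List β → M} {G : List α → List β → N} {a d p q : ℕ}
    (hF : SuppDeg a p F) (hG : SuppDeg d q G) (H : List α → List β → M') :
    conv b' F (conv c G H) = (-1 : ℤ) ^ ((p + a) * (q + d)) • conv c' G (conv b F H) := by
  have h0 : conv (0 : M →ₗ[𝕜] M' →ₗ[𝕜] Q) (conv (0 : M →ₗ[𝕜] N →ₗ[𝕜] M) F G) H = 0 := by
    funext es fs
    simp only [conv, LinearMap.zero_apply, shw_zero, Pi.zero_apply]
  rw [conv_leibniz b' c (0 : M →ₗ[𝕜] N →ₗ[𝕜] M) 0 b c' (fun x y z => ?_) hF hG, h0, zero_add]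
  rw [h, LinearMap.zero_apply, LinearMap.zero_apply, zero_add]

lemma conv_right_comm {Q : Type*} [AddCommGroup Q] [Module 𝕜 Q]
    (b' : P →ₗ[𝕜] M' →ₗ[𝕜] Q) (b : M →ₗ[𝕜] N →ₗ[𝕜] P)
    (c : M →ₗ[𝕜] M' →ₗ[𝕜] P') (c' : P' →ₗ[𝕜] N →ₗ[𝕜] Q)
    (h : ∀ x y z, b' (b x y) z = c' (c x z) y)
    {F : List α → List β → M} {G : List α → List β → N} {H : List α → List β → M'}
    {a d e p q r : ℕ} (hF : SuppDeg a p F) (hG : SuppDeg d q G) (hH : SuppDeg e r H) :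
    conv b' (conv b F G) H = (-1 : ℤ) ^ ((q + d) * (r + e)) • conv c' (conv c F H) G := by
  rw [conv_swap _ (hF.conv hG) hH,
    ← conv_assoc c.flip c' b b'.flip (fun z x y => (h x y z).symm), conv_swap c hF hH,
    conv_smul_left, smul_smul, ← pow_add]
  congr 1
  refine neg_one_pow_congr ?_
  simp only [Nat.even_add, Nat.even_mul]
  grind

lemma conv_snoc (b : M →ₗ[𝕜] N →ₗ[𝕜] P) (F : List α → List β → M)
    (G : List α → List β → N) (es : List α) (e : α) (fs : List β) :
    conv b F G (es ++ [e]) fs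
      = conv b (fun x u => F (x ++ [e]) u) (fun y v => (-1 : ℤ) ^ y.length • G y v) es fs
        + conv b F (fun y v => G (y ++ [e]) v) es fs := by
  simp only [conv, shw_snoc, map_zsmul, shw_smul]

lemma conv_cons (b : M →ₗ[𝕜] N →ₗ[𝕜] P) (F : List α → List β → M)
    (G : List α → List β → N) (es : List α) (f : β) (fs : List β) :
    conv b F G es (f :: fs)
      = conv b (fun x u => F x (f :: u)) G es fs + conv b F (fun y v => G y (f :: v)) es fs := by
  simp only [conv, shw, one_pow, one_smul, shw_add]

end Convolution

section SumsOfShuffles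

variable {α β M : Type*} [AddCommGroup M]

lemma shSumU_sub (fs : List β) {i : ℕ} (hi : i ≤ fs.length) (F : List β → List β → M) :
    shSumU (fs.length - i) fs F = shSumU i fs (fun u v => F v u) := by
  rw [shSumU_eq_shw_swap, shSumU_eq_shw]
  refine shw_congr _ _ fun u v huv => ?_
  have h : v.length = fs.length - i ↔ u.length = i := by omega
  simp only [h]

lemma sum_shSum (es : List α) (fs : List β) (g : ℕ → Prop) [DecidablePred g] (p : ℕ → ℕ)
    (T : ℕ → List α → List α → List β → List β → M) :
    (∑ i ∈ Finset.range (fs.length + 1),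
      if g i then shSum (p i) es fun x y => shSumU i fs fun u v => T i x y u v else 0)
    = shw (-1) es fun x y => shw 1 fs fun u v =>
        if g u.length ∧ x.length = p u.length then T u.length x y u v else 0 := by
  have h : ∀ i, (if g i then shSum (p i) es fun x y => shSumU i fs fun u v => T i x y u v else 0)
      = shw (-1) es fun x y => shw 1 fs fun u v =>
          if u.length = i then if g i ∧ x.length = p i then T i x y u v else 0 else 0 := by
    intro i
    by_cases hg : g i
    · simp only [hg, if_true, true_and, shSum_eq_shw, shSumU_eq_shw]
      refine shw_congr _ _ fun x y _ => ?_
      by_cases hx : x.length = p i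
      · simp only [hx, if_true]
      · simp only [hx, if_false, ite_self, shw_zero]
    · simp only [hg, if_false, false_and, ite_self, shw_zero]
  simp only [h, ← shw_sum]
  refine shw_congr _ _ fun x y _ => shw_congr _ _ fun u v huv => ?_
  rw [Finset.sum_ite_eq, if_pos (Finset.mem_range.mpr (by omega))]

end SumsOfShuffles

section ZeroCochains

lemma cmul_zero_left {𝕜 : Type u} [Field 𝕜] {L : Type v} [AddCommGroup L] [Module 𝕜 L]
    (A : LeibnizAlg 𝕜 L) (S : Type w) [CommRing S] (n m : ℕ)
    (η : ℕ → List L → List A.leftCenter → S) :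
    cmul A S n m 0 η = 0 := by
  funext k es fs
  simp only [cmul, Pi.zero_apply, zero_mul, shSum_eq_shw, shSumU_eq_shw, ite_self, shw_zero,
    Finset.sum_const_zero]

lemma cmul_zero_right {𝕜 : Type u} [Field 𝕜] {L : Type v} [AddCommGroup L] [Module 𝕜 L]
    (A : LeibnizAlg 𝕜 L) (S : Type w) [CommRing S] (n m : ℕ)
    (ω : ℕ → List L → List A.leftCenter → S) :
    cmul A S n m ω 0 = 0 := by
  funext k es fs
  simp only [cmul, Pi.zero_apply, mul_zero, shSum_eq_shw, shSumU_eq_shw, ite_self, shw_zero,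
    Finset.sum_const_zero]

end ZeroCochains

section Poisson

variable {𝕜 : Type u} [Field 𝕜] {L : Type v} [AddCommGroup L] [Module 𝕜 L]
variable (A : LeibnizAlg 𝕜 L)
variable (S : Type w) [CommRing S] [Algebra 𝕜 S]
variable (ι : A.leftCenter →ₗ[𝕜] S)

lemma trunc_eq_zero_of_lt {α β M : Type*} [AddCommGroup M] {a p : ℕ} (h : p < a)
    (f : ℕ → List α → List β → M) : trunc a p f = 0 := by
  funext x u
  exact if_neg (by omega)

lemma cmul_eq_conv {n m a c : ℕ} (ω η : ℕ → List L → List A.leftCenter → S)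
    (ha : a ≤ n) (hc : c ≤ m) (es : List L) (fs : List A.leftCenter)
    (h : 2 * fs.length + es.length + a + c = n + m) :
    cmul A S (n - a) (m - c) ω η fs.length es fs
      = conv (LinearMap.mul 𝕜 S) (trunc a n ω) (trunc c m η) es fs := by
  rw [cmul, sum_shSum es fs (fun i => 2 * i ≤ n - a ∧ 2 * (fs.length - i) ≤ m - c)
    (fun i => n - a - 2 * i) fun i x y u v => ω i x u * η (fs.length - i) y v]
  refine shw_congr _ _ fun x y hxy => shw_congr _ _ fun u v huv => ?_
  have hv : fs.length - u.length = v.length := by omega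
  rw [LinearMap.mul_apply', trunc, trunc, hv]
  by_cases h1 : 2 * u.length + x.length + a = n
  · rw [if_pos h1, if_pos (by omega), if_pos (by omega)]
  · rw [if_neg h1, if_neg (by omega), zero_mul]

lemma trunc_cmul (n m : ℕ) (ω η : ℕ → List L → List A.leftCenter → S) :
    trunc 0 (n + m) (cmul A S n m ω η)
      = conv (LinearMap.mul 𝕜 S) (trunc 0 n ω) (trunc 0 m η) := by
  funext es fs
  by_cases h : 2 * fs.length + es.length + 0 = n + m
  · rw [trunc, if_pos h]
    exact cmul_eq_conv A S ω η (Nat.zero_le n) (Nat.zero_le m) es fs h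
  · rw [suppDeg_trunc _ _ _ _ _ h, ((suppDeg_trunc 0 n ω).conv (suppDeg_trunc 0 m η)) _ _ h]

section Pairing

lemma pairT_tmul (s t : S) (e e' : L) :
    pairT A S ι (s ⊗ₜ e) (t ⊗ₜ e') = s * t * ι (A.spZ e e') := by
  rfl

lemma pairT_symm (x y : S ⊗[𝕜] L) : pairT A S ι x y = pairT A S ι y x := by
  have h : pairT A S ι = (pairT A S ι).flip := by
    refine TensorProduct.ext' fun s e => TensorProduct.ext' fun t e' => ?_
    have hs : A.spZ e e' = A.spZ e' e := Subtype.ext (add_comm _ _)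
    rw [LinearMap.flip_apply, pairT_tmul, pairT_tmul, mul_comm s t, hs]
  exact LinearMap.congr_fun₂ h x y

lemma pairT_smul_left (s : S) (x y : S ⊗[𝕜] L) :
    pairT A S ι (s • x) y = s * pairT A S ι x y := by
  induction x with
  | zero => simp
  | add x₁ x₂ h₁ h₂ => simp only [smul_add, map_add, LinearMap.add_apply, h₁, h₂, mul_add]
  | tmul t e =>
    induction y with
    | zero => simp
    | add y₁ y₂ h₁ h₂ => simp only [map_add, h₁, h₂, mul_add]
    | tmul t' e' => simp only [TensorProduct.smul_tmul', smul_eq_mul, pairT_tmul, mul_assoc]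

lemma pairT_tmul_left (s : S) (e : L) (y : S ⊗[𝕜] L) :
    pairT A S ι (s ⊗ₜ e) y = s * pairT A S ι y (1 ⊗ₜ e) := by
  rw [pairT_symm A S ι y, ← pairT_smul_left, TensorProduct.smul_tmul', smul_eq_mul, mul_one]

variable {A S ι}

lemma IsPre.pairT_trunc {n : ℕ} {ω : ℕ → List L → List A.leftCenter → S}
    {ωt : ℕ → List L → List A.leftCenter → S ⊗[𝕜] L} (h : IsPre A S ι n ω ωt)
    (s : S) (e : L) (es : List L) (fs : List A.leftCenter) :
    pairT A S ι (s ⊗ₜ e) (trunc 1 n ωt es fs) = s * trunc 0 n ω (es ++ [e]) fs := by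
  rw [pairT_tmul_left, trunc, trunc, List.length_append, List.length_singleton]
  by_cases hd : 2 * fs.length + es.length + 1 = n
  · rw [if_pos hd, if_pos (by omega), h _ _ _ (by omega) rfl]
  · rw [if_neg hd, if_neg (by omega), map_zero, LinearMap.zero_apply]

/-- Pairing with a preimage of a product obeys the graded Leibniz rule. -/
lemma IsPre.pairT_cmul {m l : ℕ} {η lam : ℕ → List L → List A.leftCenter → S}
    {ηt lamt mt : ℕ → List L → List A.leftCenter → S ⊗[𝕜] L}
    (hηt : IsPre A S ι m η ηt) (hlamt : IsPre A S ι l lam lamt)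
    (hmt : IsPre A S ι (m + l) (cmul A S m l η lam) mt) :
    (fun es fs => (pairT A S ι).flip (trunc 1 (m + l) mt es fs))
      = (-1 : ℤ) ^ l • conv (Algebra.lsmul 𝕜 𝕜 (S ⊗[𝕜] L →ₗ[𝕜] S)).toLinearMap.flip
            (fun es fs => (pairT A S ι).flip (trunc 1 m ηt es fs)) (trunc 0 l lam)
        + conv (Algebra.lsmul 𝕜 𝕜 (S ⊗[𝕜] L →ₗ[𝕜] S)).toLinearMap (trunc 0 m η)
            (fun es fs => (pairT A S ι).flip (trunc 1 l lamt es fs)) := by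
  funext es fs
  refine TensorProduct.ext' fun s e => ?_
  rw [Pi.add_apply, Pi.add_apply, LinearMap.add_apply, Pi.smul_apply, Pi.smul_apply,
    LinearMap.smul_apply, conv_apply, conv_apply, LinearMap.flip_apply, hmt.pairT_trunc, trunc_cmul, conv_snoc,
    mul_add, ← LinearMap.mul_apply' (R := 𝕜), map_conv, ← LinearMap.mul_apply' (R := 𝕜), map_conv]
  congr 1
  · rw [← Pi.smul_apply, ← Pi.smul_apply, ← conv_smul_right]
    refine shw_congr _ _ fun x y _ => shw_congr _ _ fun u v _ => ?_
    have hy : (-1 : ℤ) ^ y.length • trunc 0 l lam y v = (-1 : ℤ) ^ l • trunc 0 l lam y v := by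
      by_cases hd : 2 * v.length + y.length + 0 = l
      · congr 1
        refine neg_one_pow_congr ?_
        rw [← hd]
        simp only [Nat.even_mul, Nat.even_add, even_two, true_or, true_iff, add_zero]
      · rw [suppDeg_trunc _ _ _ _ _ hd, smul_zero, smul_zero]
    simp only [hy, LinearMap.compr₂_apply, LinearMap.mul_apply', Pi.smul_apply,
      LinearMap.flip_apply, AlgHom.toLinearMap_apply, LinearMap.applyₗ_apply_apply,
      Algebra.lsmul_coe, LinearMap.smul_apply, hηt.pairT_trunc, smul_eq_mul]
    ring
  · refine shw_congr _ _ fun x y _ => shw_congr _ _ fun u v _ => ?_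
    simp only [LinearMap.compr₂_apply, LinearMap.mul_apply',
      LinearMap.flip_apply, AlgHom.toLinearMap_apply, LinearMap.applyₗ_apply_apply,
      Algebra.lsmul_coe, LinearMap.smul_apply, hlamt.pairT_trunc, smul_eq_mul]
    ring

end Pairing

section Derivations

lemma IsSymAlg.adjoin_range_eq_top {Z : Type v} [AddCommGroup Z] [Module 𝕜 Z] {S : Type w}
    [CommRing S] [Algebra 𝕜 S] {ι : Z →ₗ[𝕜] S} (hS : IsSymAlg S ι) :
    Algebra.adjoin 𝕜 (Set.range ι) = ⊤ := by
  set T := Algebra.adjoin 𝕜 (Set.range ι)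
  let g : Z →ₗ[𝕜] T := ι.codRestrict (Subalgebra.toSubmodule T) fun z =>
    Algebra.subset_adjoin ⟨z, rfl⟩
  let eT : ULift.{max u v} T ≃ₐ[𝕜] T := ULift.algEquiv
  let eS : ULift.{max u v} S ≃ₐ[𝕜] S := ULift.algEquiv
  obtain ⟨h, hh, -⟩ := hS (ULift.{max u v} T) (eT.symm.toLinearMap ∘ₗ g)
  obtain ⟨_, _, huniq⟩ := hS (ULift.{max u v} S) (eS.symm.toLinearMap ∘ₗ ι)
  have h1 := huniq eS.symm.toAlgHom fun z => rfl
  have h2 := huniq (eS.symm.toAlgHom.comp (T.val.comp (eT.toAlgHom.comp h))) fun z => by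
    simp only [AlgHom.comp_apply, hh]
    rfl
  refine Algebra.eq_top_iff.mpr fun x => ?_
  have h3 := congrArg eS (DFunLike.congr_fun (h2.trans h1.symm) x)
  have h4 : ((eT (h x) : T) : S) = x := h3
  exact h4 ▸ (eT (h x)).2

variable {A S ι}

/-- The derivation-valued cochain determined by a Leibniz-rule extension, truncated to its
degree. -/
def IsExt.der {n : ℕ} {ω : ℕ → List L → List A.leftCenter → S}
    {ωc : ℕ → List L → S → List A.leftCenter → S} (h : IsExt A S ι n ω ωc)
    (es : List L) (fs : List A.leftCenter) : Derivation 𝕜 S S :=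
  if hd : 2 * fs.length + es.length + 2 = n then
    Derivation.mk'
      { toFun := fun x => ωc fs.length es x fs
        map_add' := fun x y => h.map_add _ _ _ x y (by omega) rfl
        map_smul' := fun c x => h.map_smul _ _ _ c x (by omega) rfl }
      (fun x y => h.mul_rule _ _ _ x y (by omega) rfl)
  else 0

variable {n m l : ℕ} {ω η lam : ℕ → List L → List A.leftCenter → S}
    {ωc ηc lamc mc : ℕ → List L → S → List A.leftCenter → S}

lemma IsExt.suppDeg_der (h : IsExt A S ι n ω ωc) : SuppDeg 2 n h.der :=
  fun _ _ hd => dif_neg hd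

lemma IsExt.der_apply (h : IsExt A S ι n ω ωc) {es : List L} {fs : List A.leftCenter}
    (hd : 2 * fs.length + es.length + 2 = n) (x : S) :
    h.der es fs x = ωc fs.length es x fs := by
  rw [IsExt.der, dif_pos hd]
  rfl

lemma IsExt.der_gen (h : IsExt A S ι n ω ωc) (es : List L) (fs : List A.leftCenter)
    (f : A.leftCenter) : h.der es fs (ι f) = trunc 0 n ω es (f :: fs) := by
  rw [trunc, List.length_cons]
  by_cases hd : 2 * fs.length + es.length + 2 = n
  · rw [h.der_apply hd, if_pos (by omega), h.on_gen _ _ _ _ (by omega) rfl]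
  · rw [h.suppDeg_der _ _ hd, if_neg (by omega), Derivation.coe_zero, Pi.zero_apply]

variable (𝕜 S) in
/-- Application of derivations, as a bilinear map. -/
def derApp : Derivation 𝕜 S S →ₗ[𝕜] S →ₗ[𝕜] S :=
  LinearMap.mk₂ 𝕜 (fun D x => D x) (fun _ _ _ => rfl) (fun _ _ _ => rfl)
    (fun D x y => map_add D x y) (fun c D x => D.map_smul c x)

lemma derApp_apply (D : Derivation 𝕜 S S) (x : S) : derApp 𝕜 S D x = D x := rfl

lemma derApp_conv {α β M N : Type*} [AddCommGroup M] [Module 𝕜 M] [AddCommGroup N] [Module 𝕜 N]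
    (b : M →ₗ[𝕜] N →ₗ[𝕜] Derivation 𝕜 S S) (F : List α → List β → M) (G : List α → List β → N)
    (es : List α) (fs : List β) (x : S) :
    conv b F G es fs x = conv (b.compr₂ ((derApp 𝕜 S).flip x)) F G es fs :=
  map_conv ((derApp 𝕜 S).flip x) b F G es fs

/-- The Leibniz-rule extension of a product. -/
lemma IsExt.der_cmul (hS : IsSymAlg S ι) (hη : IsExt A S ι m η ηc) (hlam : IsExt A S ι l lam lamc)
    (hm : IsExt A S ι (m + l) (cmul A S m l η lam) mc) :
    hm.der = conv (Algebra.lsmul 𝕜 𝕜 (Derivation 𝕜 S S)).toLinearMap.flip hη.der (trunc 0 l lam)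
      + conv (Algebra.lsmul 𝕜 𝕜 (Derivation 𝕜 S S)).toLinearMap (trunc 0 m η) hlam.der := by
  funext es fs
  refine Derivation.ext_of_adjoin_eq_top _ hS.adjoin_range_eq_top ?_
  rintro _ ⟨f, rfl⟩
  rw [hm.der_gen, trunc_cmul, conv_cons, Pi.add_apply, Pi.add_apply, Derivation.add_apply,
    derApp_conv, derApp_conv]
  congr 1
  · refine shw_congr _ _ fun x y _ => shw_congr _ _ fun u v _ => ?_
    simp only [← hη.der_gen, LinearMap.compr₂_apply, LinearMap.mul_apply', LinearMap.flip_apply,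
      AlgHom.toLinearMap_apply, Algebra.lsmul_coe, derApp_apply, Derivation.smul_apply,
      smul_eq_mul]
    ring
  · refine shw_congr _ _ fun x y _ => shw_congr _ _ fun u v _ => ?_
    simp only [← hlam.der_gen, LinearMap.compr₂_apply, LinearMap.mul_apply', LinearMap.flip_apply,
      AlgHom.toLinearMap_apply, Algebra.lsmul_coe, derApp_apply, Derivation.smul_apply,
      smul_eq_mul]

lemma IsExt.cdiam_eq_conv (h : IsExt A S ι n ω ωc) (η : ℕ → List L → List A.leftCenter → S)
    (es : List L) (fs : List A.leftCenter) (hd : 2 * fs.length + es.length + 2 = n + m) :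
    cdiam A S n m ωc η fs.length es fs
      = conv (derApp 𝕜 S) h.der (trunc 0 m η) es fs := by
  have hsub : cdiam A S n m ωc η fs.length es fs
      = ∑ i ∈ Finset.range (fs.length + 1),
        if 2 * (i + 1) ≤ n ∧ 2 * (fs.length - i) ≤ m then
          shSum (n - 2 * i - 2) es fun x y =>
            shSumU i fs fun u v => ωc i x (η (fs.length - i) y v) u
        else 0 := by
    refine Finset.sum_congr rfl fun i hi => ?_
    have hi' : i ≤ fs.length := by
      rw [Finset.mem_range] at hi
      omega
    simp only [shSumU_sub fs hi']
  rw [hsub, sum_shSum es fs (fun i => 2 * (i + 1) ≤ n ∧ 2 * (fs.length - i) ≤ m)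
    (fun i => n - 2 * i - 2) fun i x y u v => ωc i x (η (fs.length - i) y v) u]
  refine shw_congr _ _ fun x y hxy => shw_congr _ _ fun u v huv => ?_
  have hv : fs.length - u.length = v.length := by omega
  rw [derApp_apply, hv, trunc]
  by_cases h1 : 2 * u.length + x.length + 2 = n
  · rw [h.der_apply h1, if_pos (by omega), if_pos (by omega)]
  · rw [h.suppDeg_der _ _ h1, if_neg (by omega), Derivation.coe_zero, Pi.zero_apply]

end Derivations

lemma cbull_eq_conv (n m : ℕ) (ωt ηt : ℕ → List L → List A.leftCenter → S ⊗[𝕜] L)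
    (es : List L) (fs : List A.leftCenter) (hd : 2 * fs.length + es.length + 2 = n + m) :
    cbull A S ι n m ωt ηt fs.length es fs
      = (-1 : ℤ) ^ (m - 1) • conv (pairT A S ι) (trunc 1 n ωt) (trunc 1 m ηt) es fs := by
  rw [cbull, sum_shSum es fs (fun i => 2 * i + 1 ≤ n ∧ 2 * (fs.length - i) + 1 ≤ m)
    (fun i => n - 2 * i - 1) fun i x y u v => pairT A S ι (ωt i x u) (ηt (fs.length - i) y v)]
  congr 1
  refine shw_congr _ _ fun x y hxy => shw_congr _ _ fun u v huv => ?_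
  have hv : fs.length - u.length = v.length := by omega
  rw [hv, trunc, trunc]
  by_cases h1 : 2 * u.length + x.length + 1 = n
  · rw [if_pos h1]
    by_cases h2 : 2 * v.length + y.length + 1 = m
    · rw [if_pos h2, if_pos (by omega)]
    · omega
  · rw [if_neg h1, if_neg (by omega), map_zero, LinearMap.zero_apply]

variable {A S ι}
variable {n m : ℕ} {ω η : ℕ → List L → List A.leftCenter → S}
  {ωc ηc : ℕ → List L → S → List A.leftCenter → S}

lemma cpbr_eq_zero_of_lt (h : n + m < 2)
    (ωt ηt : ℕ → List L → List A.leftCenter → S ⊗[𝕜] L) :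
    cpbr A S ι n m ω η ωt ηt ωc ηc = 0 := by
  funext k es fs
  rw [cpbr, cbull, cdiam, cdiam, Finset.sum_eq_zero, Finset.sum_eq_zero, Finset.sum_eq_zero,
    smul_zero, smul_zero, add_zero, sub_zero]
  · rfl
  all_goals exact fun i _ => if_neg (by omega)

lemma trunc_cpbr (hω : IsExt A S ι n ω ωc) (hη : IsExt A S ι m η ηc)
    (ωt ηt : ℕ → List L → List A.leftCenter → S ⊗[𝕜] L) :
    trunc 2 (n + m) (cpbr A S ι n m ω η ωt ηt ωc ηc)
      = (-1 : ℤ) ^ (m - 1) • conv (pairT A S ι) (trunc 1 n ωt) (trunc 1 m ηt)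
        + conv (derApp 𝕜 S) hω.der (trunc 0 m η)
        - (-1 : ℤ) ^ (n * m) • conv (derApp 𝕜 S) hη.der (trunc 0 n ω) := by
  funext es fs
  simp only [Pi.sub_apply, Pi.add_apply, Pi.smul_apply]
  by_cases hd : 2 * fs.length + es.length + 2 = n + m
  · rw [trunc, if_pos hd, cpbr, cbull_eq_conv A S ι n m ωt ηt es fs hd,
      hω.cdiam_eq_conv η es fs hd, hη.cdiam_eq_conv ω es fs (by omega)]
  · rw [suppDeg_trunc _ _ _ _ _ hd,
      (suppDeg_trunc 1 n ωt).conv (suppDeg_trunc 1 m ηt) _ _ hd,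
      hω.suppDeg_der.conv (suppDeg_trunc 0 m η) _ _ hd,
      hη.suppDeg_der.conv (suppDeg_trunc 0 n ω) _ _ (by omega)]
    simp only [smul_zero, add_zero, sub_zero]

section LeibnizRules

variable {l : ℕ} {lam : ℕ → List L → List A.leftCenter → S}
  {ηt lamt pt : ℕ → List L → List A.leftCenter → S ⊗[𝕜] L}
  {lamc pc : ℕ → List L → S → List A.leftCenter → S}

lemma conv_pairT_cmul (ωt : ℕ → List L → List A.leftCenter → S ⊗[𝕜] L)
    (hηt : IsPre A S ι m η ηt) (hlamt : IsPre A S ι l lam lamt)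
    (hpt : IsPre A S ι (m + l) (cmul A S m l η lam) pt) :
    conv (pairT A S ι) (trunc 1 n ωt) (trunc 1 (m + l) pt)
      = (-1 : ℤ) ^ l • conv (LinearMap.mul 𝕜 S)
            (conv (pairT A S ι) (trunc 1 n ωt) (trunc 1 m ηt)) (trunc 0 l lam)
        + (-1 : ℤ) ^ ((n + 1) * m) • conv (LinearMap.mul 𝕜 S) (trunc 0 m η)
            (conv (pairT A S ι) (trunc 1 n ωt) (trunc 1 l lamt)) := by
  have hflip : ∀ G : List L → List A.leftCenter → S ⊗[𝕜] L,
      conv (pairT A S ι) (trunc 1 n ωt) G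
        = conv LinearMap.id.flip (trunc 1 n ωt) fun es fs => (pairT A S ι).flip (G es fs) :=
    fun _ => rfl
  rw [hflip, IsPre.pairT_cmul hηt hlamt hpt, conv_add_right, conv_smul_right, hflip, hflip]
  congr 2
  · exact (conv_assoc _ _ _ _ (fun x φ s => mul_comm _ _) _ _ _).symm
  · exact conv_left_comm _ _ _ _ (fun x s φ => rfl) (suppDeg_trunc 1 n ωt) (suppDeg_trunc 0 m η) _

lemma IsExt.conv_der_mul (hω : IsExt A S ι n ω ωc) (η lam : ℕ → List L → List A.leftCenter → S) :
    conv (derApp 𝕜 S) hω.der (conv (LinearMap.mul 𝕜 S) (trunc 0 m η) (trunc 0 l lam))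
      = conv (LinearMap.mul 𝕜 S) (conv (derApp 𝕜 S) hω.der (trunc 0 m η)) (trunc 0 l lam)
        + (-1 : ℤ) ^ (n * m) • conv (LinearMap.mul 𝕜 S) (trunc 0 m η)
            (conv (derApp 𝕜 S) hω.der (trunc 0 l lam)) := by
  have hsign : (-1 : ℤ) ^ ((n + 2) * (m + 0)) = (-1) ^ (n * m) := by
    rw [add_zero, add_mul, pow_add, pow_mul (-1) 2, neg_one_sq, one_pow, mul_one]
  rw [← hsign]
  refine conv_leibniz _ _ _ _ _ _ (fun D y z => ?_) hω.suppDeg_der (suppDeg_trunc 0 m η) _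
  simp only [derApp_apply, LinearMap.mul_apply', Derivation.leibniz, smul_eq_mul]
  ring

lemma IsExt.conv_der_cmul (hp : IsExt A S ι (m + l) (cmul A S m l η lam) pc) (hS : IsSymAlg S ι)
    (hη : IsExt A S ι m η ηc) (hlam : IsExt A S ι l lam lamc) :
    conv (derApp 𝕜 S) hp.der (trunc 0 n ω)
      = (-1 : ℤ) ^ (l * n) • conv (LinearMap.mul 𝕜 S)
            (conv (derApp 𝕜 S) hη.der (trunc 0 n ω)) (trunc 0 l lam)
        + conv (LinearMap.mul 𝕜 S) (trunc 0 m η)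
            (conv (derApp 𝕜 S) hlam.der (trunc 0 n ω)) := by
  rw [IsExt.der_cmul hS hη hlam hp, conv_add_left]
  congr 1
  · exact conv_right_comm _ _ _ _ (fun D y z => mul_comm _ _) hη.suppDeg_der
      (suppDeg_trunc 0 l lam) (suppDeg_trunc 0 n ω)
  · exact conv_assoc _ _ _ _ (fun x y z => rfl) _ _ _

end LeibnizRules

end Poisson

section Theorems

variable {𝕜 : Type u} [Field 𝕜] {L : Type v} [AddCommGroup L] [Module 𝕜 L]

theorem cpbr_leibniz (A : LeibnizAlg 𝕜 L) (S : Type w) [CommRing S] [Algebra 𝕜 S]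
    (ι : A.leftCenter →ₗ[𝕜] S) (hS : IsSymAlg S ι)
    (n m l : ℕ) (ω η lam : ℕ → List L → List A.leftCenter → S)
    (hω : IsCochain A S n ω) (hη : IsCochain A S m η) (hlam : IsCochain A S l lam)
    (ωt ηt lamt mt : ℕ → List L → List A.leftCenter → S ⊗[𝕜] L)
    (hωt : IsPre A S ι n ω ωt) (hηt : IsPre A S ι m η ηt)
    (hlamt : IsPre A S ι l lam lamt)
    (hmt : IsPre A S ι (m+l) (cmul A S m l η lam) mt)
    (ωc ηc lamc mc : ℕ → List L → S → List A.leftCenter → S)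
    (hωc : IsExt A S ι n ω ωc) (hηc : IsExt A S ι m η ηc)
    (hlamc : IsExt A S ι l lam lamc)
    (hmc : IsExt A S ι (m+l) (cmul A S m l η lam) mc) :
    ∀ (k : ℕ) (es : List L) (fs : List A.leftCenter),
      2*k + es.length + 2 = n + m + l → fs.length = k →
      cpbr A S ι n (m+l) ω (cmul A S m l η lam) ωt mt ωc mc k es fs
        = cmul A S (n+m-2) l (cpbr A S ι n m ω η ωt ηt ωc ηc) lam k es fs
          + (-1 : ℤ)^(n*m) •
              cmul A S m (n+l-2) η (cpbr A S ι n l ω lam ωt lamt ωc lamc) k es fs := by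
  rintro _ es fs hd rfl
  have hl : cmul A S (n+m-2) l (cpbr A S ι n m ω η ωt ηt ωc ηc) lam fs.length es fs
      = conv (LinearMap.mul 𝕜 S) (trunc 2 (n + m) (cpbr A S ι n m ω η ωt ηt ωc ηc))
          (trunc 0 l lam) es fs := by
    rcases lt_or_ge (n + m) 2 with h | h
    · rw [cpbr_eq_zero_of_lt h, cmul_zero_left, trunc_eq_zero_of_lt h, conv_zero_left]
      rfl
    · exact cmul_eq_conv A S _ _ h (Nat.zero_le l) es fs (by omega)
  have hr : cmul A S m (n+l-2) η (cpbr A S ι n l ω lam ωt lamt ωc lamc) fs.length es fs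
      = conv (LinearMap.mul 𝕜 S) (trunc 0 m η)
          (trunc 2 (n + l) (cpbr A S ι n l ω lam ωt lamt ωc lamc)) es fs := by
    rcases lt_or_ge (n + l) 2 with h | h
    · rw [cpbr_eq_zero_of_lt h, cmul_zero_right, trunc_eq_zero_of_lt h, conv_zero_right]
      rfl
    · exact cmul_eq_conv A S _ _ (Nat.zero_le m) h es fs (by omega)
  have hb : cpbr A S ι n (m+l) ω (cmul A S m l η lam) ωt mt ωc mc fs.length es fs
      = trunc 2 (n + (m + l)) (cpbr A S ι n (m+l) ω (cmul A S m l η lam) ωt mt ωc mc) es fs :=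
    (if_pos (by omega)).symm
  rw [hl, hr, hb, ← Pi.smul_apply, ← Pi.smul_apply, ← Pi.add_apply, ← Pi.add_apply]
  refine congrFun (congrFun ?_ es) fs
  rw [trunc_cpbr hωc hmc, trunc_cpbr hωc hηc, trunc_cpbr hωc hlamc, trunc_cmul,
    conv_pairT_cmul ωt hηt hlamt hmt, hωc.conv_der_mul, hmc.conv_der_cmul hS hηc hlamc]
  simp only [sub_eq_add_neg, ← neg_smul, conv_add_left, conv_add_right, conv_smul_left,
    conv_smul_right, smul_add, smul_smul]
  have hX₁ : ((-1 : ℤ) ^ (m + l - 1) * (-1) ^ l) • conv (LinearMap.mul 𝕜 S)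
      (conv (pairT A S ι) (trunc 1 n ωt) (trunc 1 m ηt)) (trunc 0 l lam)
      = (-1 : ℤ) ^ (m - 1) • conv (LinearMap.mul 𝕜 S)
        (conv (pairT A S ι) (trunc 1 n ωt) (trunc 1 m ηt)) (trunc 0 l lam) := by
    rcases m with _ | m
    · rw [trunc_eq_zero_of_lt (a := 1) one_pos ηt, conv_zero_right, conv_zero_left, smul_zero,
        smul_zero]
    · rw [← pow_add]
      congr 1
      refine neg_one_pow_congr ?_
      rw [show m + 1 + l - 1 = m + l by omega, Nat.add_sub_cancel]
      simp only [Nat.even_add]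
      tauto
  have hX₂ : ((-1 : ℤ) ^ (m + l - 1) * (-1) ^ ((n + 1) * m)) • conv (LinearMap.mul 𝕜 S)
      (trunc 0 m η) (conv (pairT A S ι) (trunc 1 n ωt) (trunc 1 l lamt))
      = ((-1 : ℤ) ^ (n * m) * (-1) ^ (l - 1)) • conv (LinearMap.mul 𝕜 S)
        (trunc 0 m η) (conv (pairT A S ι) (trunc 1 n ωt) (trunc 1 l lamt)) := by
    rcases l with _ | l
    · rw [trunc_eq_zero_of_lt (a := 1) one_pos lamt, conv_zero_right, conv_zero_right, smul_zero,
        smul_zero]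
    · rw [← pow_add, ← pow_add]
      congr 1
      refine neg_one_pow_congr ?_
      rw [show m + (l + 1) - 1 = m + l by omega, Nat.add_sub_cancel, add_mul, one_mul]
      simp only [Nat.even_add]
      tauto
  have hZ₁ : (-1 : ℤ) ^ (n * (m + l)) * (-1) ^ (l * n) = (-1) ^ (n * m) := by
    rw [← pow_add]
    refine neg_one_pow_congr ?_
    simp only [mul_add, Nat.even_add, mul_comm l n]
    tauto
  have hZ₂ : (-1 : ℤ) ^ (n * m) * -(-1) ^ (n * l) = -(-1) ^ (n * (m + l)) := by
    rw [mul_neg, ← pow_add, ← mul_add]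
  rw [hX₁, hX₂, hZ₁, hZ₂]
  simp only [neg_smul]
  abel

end Theorems
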